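/- Free groups are equationally Noetherian: let F be a free group and n ≥ 1. For every subset S of F[X] = F ∗ F(x_1, …, x_n) there exists a finite subset S₀ ⊆ S such that V_F(S) = V_F(S₀), i.e. a tuple (a_1, …, a_n) ∈ F^n is a solution of every equation in S if and only if it is a solution of every equation in S₀. -/

import Mathlib

open Monoid

/-- Substitution of a tuple `a : Fin n → F` for the variables: the homomorphism
`F ∗ F(x₁, …, xₙ) →* F` which is the identity on `F` and sends `xᵢ` to `aᵢ`. -/
noncomputable def substHom {F : Type*} [Group F] {n : ℕ} (a : Fin n → F) :
    Coprod F (FreeGroup (Fin n)) →* F :=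
  Coprod.lift (MonoidHom.id F) (FreeGroup.lift a)

/-- The algebraic set `V_F(S)` defined by a system of equations
`S ⊆ F[X] = F ∗ F(x₁, …, xₙ)`: the set of tuples in `Fⁿ` which are solutions of
every equation in `S`. -/
noncomputable def algSet {F : Type*} [Group F] {n : ℕ}
    (S : Set (Coprod F (FreeGroup (Fin n)))) : Set (Fin n → F) :=
  {a | ∀ w ∈ S, substHom a w = 1}

/-- Evaluation point attached to a tuple of invertible matrices. -/
noncomputable def evalPt {R : Type*} [CommRing R] {n : ℕ}
    (m : Fin n → (Matrix (Fin 2) (Fin 2) R)ˣ) :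
    Fin n × Bool × Fin 2 × Fin 2 → R :=
  fun x => if x.2.1 then (m x.1).val x.2.2.1 x.2.2.2 else (m x.1).inv x.2.2.1 x.2.2.2

/-- Every word is represented by a matrix of polynomials. -/
lemma exists_generic {G R : Type*} [Group G] [CommRing R]
    (ρ : G →* (Matrix (Fin 2) (Fin 2) R)ˣ) (n : ℕ) (w : Coprod G (FreeGroup (Fin n))) :
    ∃ P : Matrix (Fin 2) (Fin 2) (MvPolynomial (Fin n × Bool × Fin 2 × Fin 2) R),
      ∀ a : Fin n → G,
        P.map (MvPolynomial.eval (evalPt (fun i => ρ (a i)))) = (ρ (substHom a w)).val := by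
  induction w using Coprod.induction_on with
  | inl g =>
    refine ⟨(ρ g).val.map MvPolynomial.C, fun a => ?_⟩
    ext i j
    simp [substHom]
  | inr g =>
    induction g using FreeGroup.induction_on with
    | C1 =>
      refine ⟨1, fun a => ?_⟩
      simp [substHom]
    | of x =>
      refine ⟨Matrix.of fun i j => MvPolynomial.X (x, true, i, j), fun a => ?_⟩
      ext i j
      simp [substHom, evalPt]
    | inv_of x _ =>
      refine ⟨Matrix.of fun i j => MvPolynomial.X (x, false, i, j), fun a => ?_⟩
      ext i j
      simp [substHom, evalPt]
    | mul x y hx hy =>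
      obtain ⟨P, hP⟩ := hx
      obtain ⟨Q, hQ⟩ := hy
      refine ⟨P * Q, fun a => ?_⟩
      rw [Matrix.map_mul, hP, hQ]
      simp
  | mul x y hx hy =>
    obtain ⟨P, hP⟩ := hx
    obtain ⟨Q, hQ⟩ := hy
    refine ⟨P * Q, fun a => ?_⟩
    rw [Matrix.map_mul, hP, hQ]
    simp

/-- Linear groups over Noetherian rings are equationally Noetherian. -/
lemma linear_equationally_noetherian {G R : Type*} [Group G] [CommRing R] [IsNoetherianRing R]
    (ρ : G →* (Matrix (Fin 2) (Fin 2) R)ˣ) (hρ : Function.Injective ρ) (n : ℕ)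
    (S : Set (Coprod G (FreeGroup (Fin n)))) :
    ∃ S₀ : Finset (Coprod G (FreeGroup (Fin n))),
      ↑S₀ ⊆ S ∧ algSet S = algSet (S₀ : Set (Coprod G (FreeGroup (Fin n)))) := by
  classical
  choose P hP using exists_generic ρ n
  let f : Coprod G (FreeGroup (Fin n)) × Fin 2 × Fin 2 →
      MvPolynomial (Fin n × Bool × Fin 2 × Fin 2) R := fun x => (P x.1 - 1) x.2.1 x.2.2
  have key : ∀ a w, substHom a w = 1 ↔
      ∀ i j, MvPolynomial.eval (evalPt (fun i => ρ (a i))) (f (w, i, j)) = 0 := by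
    intro a w
    rw [← hρ.eq_iff, map_one, ← Units.val_inj, ← hP, Units.val_one, ← Matrix.ext_iff]
    refine forall_congr' fun i => forall_congr' fun j => ?_
    simp only [f, Matrix.sub_apply, map_sub, sub_eq_zero, Matrix.map_apply]
    by_cases h : i = j <;> simp [Matrix.one_apply, h]
  obtain ⟨t, ht, hspan⟩ := (Submodule.fg_span_iff_fg_span_finset_subset (f '' (S ×ˢ Set.univ))).1
    (IsNoetherian.noetherian (Ideal.span (f '' (S ×ˢ Set.univ))))
  obtain ⟨s, hs, rfl⟩ := Finset.subset_set_image_iff.1 ht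
  refine ⟨s.image Prod.fst, ?_, ?_⟩
  · intro w hw
    simp only [Finset.coe_image, Set.mem_image] at hw
    obtain ⟨x, hx, rfl⟩ := hw
    exact (hs hx).1
  · ext a
    constructor
    · intro h w hw
      simp only [Finset.coe_image, Set.mem_image] at hw
      obtain ⟨x, hx, rfl⟩ := hw
      exact h _ (hs hx).1
    · intro h w hw
      rw [key]
      intro i j
      have h1 : f (w, i, j) ∈ Ideal.span (f '' (S ×ˢ Set.univ)) :=
        Ideal.subset_span ⟨(w, i, j), ⟨hw, trivial⟩, rfl⟩
      have h2 : Ideal.span (f '' (S ×ˢ Set.univ)) ≤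
          RingHom.ker (MvPolynomial.eval (evalPt (fun i => ρ (a i)))) := by
        refine le_trans (le_of_eq hspan) (Ideal.span_le.2 ?_)
        intro p hp
        simp only [Finset.coe_image, Set.mem_image] at hp
        obtain ⟨⟨w', i', j'⟩, hx, rfl⟩ := hp
        refine (key a w').1 (h w' ?_) i' j'
        simp only [Finset.coe_image, Set.mem_image]
        exact ⟨_, hx, rfl⟩
      exact h2 h1

open Polynomial in
/-- The unipotent matrix `1 + s t N_c`, with `N_c` nilpotent with image and kernel `(1, c)`. -/
noncomputable def unip {k : Type*} [Field k] (s c : k) : Matrix (Fin 2) (Fin 2) k[X] :=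
  !![1 - C (s * c) * X, C s * X; - C (s * c * c) * X, 1 + C (s * c) * X]

lemma unip_mul {k : Type*} [Field k] (s s' c : k) (h : s + s' = 0) :
    unip s c * unip s' c = 1 := by
  obtain rfl : s' = - s := by linear_combination h
  ext1 i j
  fin_cases i <;> fin_cases j <;> simp [unip, Matrix.mul_apply] <;> ring

/-- The two-step letter. -/
noncomputable def letter {α k : Type*} [Field k] (c : α × Bool → k) (x : α × Bool) :
    Matrix (Fin 2) (Fin 2) (Polynomial k) :=
  unip (if x.2 then 1 else -1) (c x) * unip (if x.2 then 1 else -1) (c (x.1, !x.2))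

lemma letter_mul {α k : Type*} [Field k] (c : α × Bool → k) (a : α) (b : Bool) :
    letter c (a, b) * letter c (a, !b) = 1 := by
  have h1 := unip_mul (if b then 1 else -1) (if !b then 1 else -1) (c (a, !b))
    (by cases b <;> simp)
  have h2 := unip_mul (if b then 1 else -1) (if !b then 1 else -1) (c (a, b))
    (by cases b <;> simp)
  simp only [letter, Bool.not_not]
  rw [mul_assoc, ← mul_assoc _ _ (unip _ (c (a, b))), h1, one_mul, h2]

/-- The representation. -/
noncomputable def rep {α k : Type*} [Field k] (c : α × Bool → k) :
    FreeGroup α →* (Matrix (Fin 2) (Fin 2) (Polynomial k))ˣ :=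
  FreeGroup.lift fun a =>
    ⟨letter c (a, true), letter c (a, false), letter_mul c a true, letter_mul c a false⟩

lemma rep_mk {α k : Type*} [Field k] (c : α × Bool → k) (L : List (α × Bool)) :
    (rep c (FreeGroup.mk L)).val = (L.map (letter c)).prod := by
  induction L with
  | nil => simp [← FreeGroup.one_eq_mk]
  | cons x L ih =>
    have : FreeGroup.mk (x :: L) = FreeGroup.mk [x] * FreeGroup.mk L := by
      simp [FreeGroup.mul_mk]
    rw [this, map_mul, Units.val_mul, ih, List.map_cons, List.prod_cons]
    congr 1
    obtain ⟨a, b⟩ := x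
    cases b <;> simp [rep, FreeGroup.lift_mk, Units.inv_mk]

/-- Degree at most `m`. -/
def DegLe {k : Type*} [Field k] (m : ℕ) (v : Fin 2 → Polynomial k) : Prop :=
  ∀ i, (v i).natDegree ≤ m

/-- The coefficient of degree `m` is a nonzero multiple of `(1, d)`. -/
def LeadPt {k : Type*} [Field k] (m : ℕ) (d : k) (v : Fin 2 → Polynomial k) : Prop :=
  DegLe m v ∧ (v 0).coeff m ≠ 0 ∧ (v 1).coeff m = d * (v 0).coeff m

open Polynomial in
lemma unip_step {k : Type*} [Field k] (s c : k) (hs : s ≠ 0) (m : ℕ) (v : Fin 2 → k[X])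
    (hv : DegLe m v) (h : (v 1).coeff m - c * (v 0).coeff m ≠ 0) :
    LeadPt (m + 1) c ((unip s c).mulVec v) := by
  have e0 : (unip s c).mulVec v 0 = v 0 + C s * ((v 1 - C c * v 0) * X) := by
    simp [unip, Matrix.mulVec, dotProduct]; ring
  have e1 : (unip s c).mulVec v 1 = v 1 + C (s * c) * ((v 1 - C c * v 0) * X) := by
    simp [unip, Matrix.mulVec, dotProduct]; ring
  have hd : ∀ r i, (v i + C r * ((v 1 - C c * v 0) * X)).natDegree ≤ m + 1 := by
    intro r i
    refine natDegree_add_le_of_degree_le ((hv i).trans (Nat.le_succ m)) ?_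
    refine (natDegree_C_mul_le _ _).trans (natDegree_mul_le_of_le ?_ natDegree_X_le)
    exact natDegree_sub_le_of_le (hv 1) ((natDegree_C_mul_le _ _).trans (hv 0)) |>.trans (by simp)
  have hz : ∀ i, (v i).coeff (m + 1) = 0 := fun i =>
    coeff_eq_zero_of_natDegree_lt (Nat.lt_succ_of_le (hv i))
  refine ⟨?_, ?_, ?_⟩
  · intro i
    fin_cases i
    · simpa only [Fin.zero_eta, e0] using hd _ _
    · simpa only [Fin.mk_one, e1] using hd _ _
  · rw [e0]
    simp [hz, coeff_mul_X, hs, h]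
  · rw [e0, e1]
    simp only [coeff_add, hz, coeff_C_mul, coeff_mul_X, coeff_sub]
    ring

lemma letter_step {α k : Type*} [Field k] (c : α × Bool → k) (hc : Function.Injective c)
    (x : α × Bool) (m : ℕ) (v : Fin 2 → Polynomial k)
    (hv : DegLe m v) (h : (v 1).coeff m - c (x.1, !x.2) * (v 0).coeff m ≠ 0) :
    LeadPt (m + 2) (c x) ((letter c x).mulVec v) := by
  have hs : (if x.2 then (1 : k) else -1) ≠ 0 := by split <;> simp
  rw [letter, ← Matrix.mulVec_mulVec]
  have h1 := unip_step _ _ hs m v hv h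
  refine unip_step _ _ hs (m + 1) _ h1.1 ?_
  rw [h1.2.2, ← sub_mul]
  refine mul_ne_zero (sub_ne_zero.2 (hc.ne ?_)) h1.2.1
  obtain ⟨a, b⟩ := x
  cases b <;> simp

lemma word_lead {α k : Type*} [Field k] (c : α × Bool → k) (hc : Function.Injective c)
    (x : α × Bool) (L : List (α × Bool)) (hL : FreeGroup.IsReduced (x :: L)) :
    LeadPt (2 * (L.length + 1)) (c x)
      ((((x :: L).map (letter c)).prod).mulVec ![0, 1]) := by
  induction L generalizing x with
  | nil =>
    simp only [List.map_cons, List.map_nil, List.prod_cons, List.prod_nil, mul_one]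
    refine letter_step c hc x 0 _ ?_ ?_
    · intro i
      fin_cases i <;> simp
    · simp
  | cons y L ih =>
    rw [FreeGroup.isReduced_cons_cons] at hL
    rw [List.map_cons, List.prod_cons, ← Matrix.mulVec_mulVec]
    have h := ih y hL.2
    refine letter_step c hc x (2 * (L.length + 1)) _ h.1 ?_
    rw [h.2.2, ← sub_mul]
    refine mul_ne_zero (sub_ne_zero.2 (hc.ne ?_)) h.2.1
    intro e
    have h1 := hL.1 (by rw [e])
    rw [e] at h1
    simp at h1

lemma rep_injective {α k : Type*} [Field k] (c : α × Bool → k) (hc : Function.Injective c) :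
    Function.Injective (rep c) := by
  classical
  rw [injective_iff_map_eq_one]
  intro g hg
  have h := rep_mk c g.toWord
  rw [FreeGroup.mk_toWord, hg] at h
  have hr : FreeGroup.IsReduced g.toWord := FreeGroup.isReduced_toWord
  cases hL : g.toWord with
  | nil => exact FreeGroup.toWord_eq_nil_iff.1 hL
  | cons x L =>
    rw [hL] at h hr
    have := (word_lead c hc x L hr).2.1
    rw [← h] at this
    simp at this

/-- Free groups are equationally Noetherian: every system of equations over a free
group `F` in `n` variables is equivalent over `F` to a finite subsystem. -/
theorem freeGroup_equationally_noetherian (α : Type*) (n : ℕ) (hn : 1 ≤ n)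
    (S : Set (Coprod (FreeGroup α) (FreeGroup (Fin n)))) :
    ∃ S₀ : Finset (Coprod (FreeGroup α) (FreeGroup (Fin n))),
      ↑S₀ ⊆ S ∧ algSet S = algSet (S₀ : Set (Coprod (FreeGroup α) (FreeGroup (Fin n)))) := by
  exact linear_equationally_noetherian
    (rep fun x : α × Bool => algebraMap (MvPolynomial (α × Bool) ℚ)
      (FractionRing (MvPolynomial (α × Bool) ℚ)) (MvPolynomial.X x))
    (rep_injective _ ((IsFractionRing.injective _ _).comp (MvPolynomial.X_injective))) n S
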